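/- arXiv:1306.6821 — 5 statements merged into one kernel-verified Lean document; each statement's English description precedes it below -/
import Mathlib

section
/- Let K̂ and K be open subsets of ℝ² and F : K̂ → K a bijection that is differentiable on K̂ with differentiable inverse, and with Jacobian determinant J(x̂) = det DF(x̂) ≠ 0 for all x̂ ∈ K̂. Then for every differentiable scalar function q̂ : K̂ → ℝ and every x̂ ∈ K̂, curl(q̂ ∘ F⁻¹)(F(x̂)) = J(x̂)⁻¹ · DF(x̂) · (curl q̂)(x̂); that is, curl(P⁰ q̂) = P¹(curl q̂). -/
/-- The Jacobian determinant of a map `F : ℝ² → ℝ²` at a point. -/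
noncomputable def jacDet (F : ℝ × ℝ → ℝ × ℝ) (x : ℝ × ℝ) : ℝ :=
  LinearMap.det ((fderiv ℝ F x).toLinearMap)

/-- The two-dimensional curl of a scalar function: `curl q = (∂₂ q, −∂₁ q)`. -/
noncomputable def scurl (q : ℝ × ℝ → ℝ) (x : ℝ × ℝ) : ℝ × ℝ :=
  ((fderiv ℝ q x) (0, 1), -((fderiv ℝ q x) (1, 0)))

theorem LinearMap.det_prod_self {R : Type*} [CommRing R] (A : R × R →ₗ[R] R × R) :
    LinearMap.det A = (A (1, 0)).1 * (A (0, 1)).2 - (A (0, 1)).1 * (A (1, 0)).2 := by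
  rw [← LinearMap.det_toMatrix (Module.Basis.finTwoProd R), Matrix.det_fin_two]
  simp [LinearMap.toMatrix_apply]

theorem LinearMap.map_prod_self_eq {R M : Type*} [CommRing R] [AddCommGroup M] [Module R M]
    (A : R × R →ₗ[R] M) (s t : R) : A (s, t) = s • A (1, 0) + t • A (0, 1) := by
  simp [← map_smul, ← map_add]

/-- The algebraic identity behind the Piola transform of a rotated gradient. -/
theorem LinearMap.map_rotated_comp (A : ℝ × ℝ →ₗ[ℝ] ℝ × ℝ) (m : ℝ × ℝ →ₗ[ℝ] ℝ) :
    A (m (A (0, 1)), -m (A (1, 0))) = LinearMap.det A • (m (0, 1), -m (1, 0)) := by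
  rw [A.map_prod_self_eq, A.det_prod_self]
  obtain ⟨a, c⟩ := A (1, 0)
  obtain ⟨b, d⟩ := A (0, 1)
  rw [m.map_prod_self_eq a c, m.map_prod_self_eq b d]
  ext <;> simp <;> ring

/-- First identity of the transformation lemma (paper's equation (5)):
`curl (P⁰ q̂) = P¹ (curl q̂)`, i.e. for a diffeomorphism `F : K̂ → K` with inverse `G`
and a differentiable scalar function `q̂` on `K̂`,
`curl (q̂ ∘ F⁻¹)(F x̂) = J(x̂)⁻¹ • DF(x̂) (curl q̂)(x̂)` for every `x̂ ∈ K̂`. -/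
theorem stmt_1
    (Khat K : Set (ℝ × ℝ)) (hKhat : IsOpen Khat) (hK : IsOpen K)
    (F G : ℝ × ℝ → ℝ × ℝ)
    (hFK : F '' Khat = K)
    (hdF : ∀ xhat ∈ Khat, DifferentiableAt ℝ F xhat)
    (hdG : ∀ x ∈ K, DifferentiableAt ℝ G x)
    (hGF : ∀ xhat ∈ Khat, G (F xhat) = xhat)
    (hFG : ∀ x ∈ K, F (G x) = x)
    (hJ : ∀ xhat ∈ Khat, jacDet F xhat ≠ 0)
    (qhat : ℝ × ℝ → ℝ) (hq : ∀ xhat ∈ Khat, DifferentiableAt ℝ qhat xhat) :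
    ∀ xhat ∈ Khat,
      scurl (qhat ∘ G) (F xhat) = (jacDet F xhat)⁻¹ • (fderiv ℝ F xhat) (scurl qhat xhat) := by
  intro x hx
  have hxK : F x ∈ K := hFK ▸ Set.mem_image_of_mem F hx
  have hcomp : DifferentiableAt ℝ (qhat ∘ G) (F x) :=
    DifferentiableAt.comp (F x) (by rw [hGF x hx]; exact hq x hx) (hdG _ hxK)
  have heq : (qhat ∘ G) ∘ F =ᶠ[nhds x] qhat := by
    filter_upwards [hKhat.mem_nhds hx] with y hy
    simp [hGF y hy]
  have hfd : fderiv ℝ qhat x = (fderiv ℝ (qhat ∘ G) (F x)).comp (fderiv ℝ F x) := by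
    rw [← heq.fderiv_eq, fderiv_comp x hcomp (hdF x hx)]
  have key := LinearMap.map_rotated_comp (fderiv ℝ F x).toLinearMap
    (fderiv ℝ (qhat ∘ G) (F x)).toLinearMap
  rw [eq_inv_smul_iff₀ (hJ x hx), scurl, scurl, hfd]
  exact key.symm
end

section
/- Let K̂ and K be open subsets of ℝ² and F : K̂ → K a bijection that is twice differentiable on K̂ with differentiable inverse, and with Jacobian determinant J(x̂) = det DF(x̂) ≠ 0 for all x̂ ∈ K̂. Then for every continuously differentiable vector field v̂ : K̂ → ℝ² and every x̂ ∈ K̂, div(P¹v̂)(F(x̂)) = J(x̂)⁻¹ · (div v̂)(x̂); that is, div(P¹v̂) = P²(div v̂). -/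
/-- The divergence of a planar vector field: `div v = ∂₁ v₁ + ∂₂ v₂`. -/
noncomputable def vdiv (v : ℝ × ℝ → ℝ × ℝ) (x : ℝ × ℝ) : ℝ :=
  ((fderiv ℝ v x) (1, 0)).1 + ((fderiv ℝ v x) (0, 1)).2

/-- The Piola transform of a vector field `v̂` on `K̂`, as a vector field on `K`:
`(P¹ v̂)(F x̂) = J(x̂)⁻¹ • DF(x̂) v̂(x̂)`, expressed via the inverse map `G` of `F`. -/
noncomputable def piola (F G : ℝ × ℝ → ℝ × ℝ) (v : ℝ × ℝ → ℝ × ℝ) (x : ℝ × ℝ) : ℝ × ℝ :=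
  (jacDet F (G x))⁻¹ • (fderiv ℝ F (G x)) (v (G x))

theorem ContinuousLinearMap.apply_eq_smul_add_smul {E : Type*} [NormedAddCommGroup E]
    [NormedSpace ℝ E] (L : ℝ × ℝ →L[ℝ] E) (h : ℝ × ℝ) :
    L h = h.1 • L (1, 0) + h.2 • L (0, 1) := by
  rw [← map_smul, ← map_smul, ← map_add]
  simp

theorem ContinuousLinearMap.det_prod_eq (L : ℝ × ℝ →L[ℝ] ℝ × ℝ) :
    LinearMap.det L.toLinearMap = (L (1, 0)).1 * (L (0, 1)).2 - (L (0, 1)).1 * (L (1, 0)).2 := by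
  rw [← LinearMap.det_toMatrix (Module.Basis.finTwoProd ℝ), Matrix.det_fin_two]
  simp [LinearMap.toMatrix_apply]

theorem jacDet_eq (F : ℝ × ℝ → ℝ × ℝ) (x : ℝ × ℝ) :
    jacDet F x = (fderiv ℝ F x (1, 0)).1 * (fderiv ℝ F x (0, 1)).2
      - (fderiv ℝ F x (0, 1)).1 * (fderiv ℝ F x (1, 0)).2 :=
  ContinuousLinearMap.det_prod_eq _

/-- Jacobi formula for the Jacobian determinant of a planar map. -/
theorem exists_hasFDerivAt_jacDet {F : ℝ × ℝ → ℝ × ℝ} {x : ℝ × ℝ}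
    {D' : ℝ × ℝ →L[ℝ] ℝ × ℝ →L[ℝ] ℝ × ℝ} (hD : HasFDerivAt (fderiv ℝ F) D' x) :
    ∃ J' : ℝ × ℝ →L[ℝ] ℝ, HasFDerivAt (jacDet F) J' x ∧ ∀ h, J' h =
      (fderiv ℝ F x (1, 0)).1 * (D' h (0, 1)).2 + (fderiv ℝ F x (0, 1)).2 * (D' h (1, 0)).1
      - ((fderiv ℝ F x (0, 1)).1 * (D' h (1, 0)).2
        + (fderiv ℝ F x (1, 0)).2 * (D' h (0, 1)).1) := by
  have h1 := hD.clm_apply (hasFDerivAt_const ((1, 0) : ℝ × ℝ) x)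
  have h2 := hD.clm_apply (hasFDerivAt_const ((0, 1) : ℝ × ℝ) x)
  refine ⟨_, ((h1.fst.mul h2.snd).sub (h2.fst.mul h1.snd)).congr_of_eventuallyEq
    (Filter.Eventually.of_forall fun y => jacDet_eq F y), fun h => ?_⟩
  simp

/-- Second identity of the transformation lemma (paper's equation (5)):
`div (P¹ v̂) = P² (div v̂)`, i.e. for a twice differentiable diffeomorphism `F : K̂ → K`
with differentiable inverse `G`, nonvanishing Jacobian determinant `J`, and a `C¹`
vector field `v̂` on `K̂`, `div (P¹ v̂)(F x̂) = J(x̂)⁻¹ (div v̂)(x̂)` for every `x̂ ∈ K̂`. -/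
theorem stmt_2
    (Khat K : Set (ℝ × ℝ)) (hKhat : IsOpen Khat) (hK : IsOpen K)
    (F G : ℝ × ℝ → ℝ × ℝ)
    (hFK : F '' Khat = K)
    (hdF : ∀ xhat ∈ Khat, DifferentiableAt ℝ F xhat)
    (hdF2 : ∀ xhat ∈ Khat, DifferentiableAt ℝ (fun y => fderiv ℝ F y) xhat)
    (hdG : ∀ x ∈ K, DifferentiableAt ℝ G x)
    (hGF : ∀ xhat ∈ Khat, G (F xhat) = xhat)
    (hFG : ∀ x ∈ K, F (G x) = x)
    (hJ : ∀ xhat ∈ Khat, jacDet F xhat ≠ 0)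
    (vhat : ℝ × ℝ → ℝ × ℝ) (hv : ContDiffOn ℝ 1 vhat Khat) :
    ∀ xhat ∈ Khat,
      vdiv (piola F G vhat) (F xhat) = (jacDet F xhat)⁻¹ * vdiv vhat xhat := by
  intro x hx
  have hKn : Khat ∈ nhds x := hKhat.mem_nhds hx
  have hFx : F x ∈ K := hFK ▸ Set.mem_image_of_mem F hx
  have hJx := hJ x hx
  have hD := (hdF2 x hx).hasFDerivAt
  have hv' := ((hv.contDiffAt hKn).differentiableAt one_ne_zero).hasFDerivAt
  have hG := (hdG _ hFx).hasFDerivAt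
  obtain ⟨J', hJ', hJ'_apply⟩ := exists_hasFDerivAt_jacDet hD
  have hsymm := second_derivative_symmetric_of_eventually
    (Filter.eventually_of_mem hKn fun y hy => (hdF y hy).hasFDerivAt) hD (1, 0) (0, 1)
  have hinv : (fderiv ℝ F x).comp (fderiv ℝ G (F x)) = ContinuousLinearMap.id ℝ (ℝ × ℝ) := by
    have hF := (hdF x hx).hasFDerivAt
    rw [← hGF x hx] at hF
    have h1 := hF.comp (F x) hG
    rw [hGF x hx] at h1
    refine h1.unique ((hasFDerivAt_id (F x)).congr_of_eventuallyEq ?_)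
    exact Filter.eventually_of_mem (hK.mem_nhds hFx) hFG
  have hw := ((hasDerivAt_inv hJx).comp_hasFDerivAt x hJ').smul (hD.clm_apply hv')
  rw [← hGF x hx] at hw
  have hP := (hw.comp (F x) hG).fderiv
  rw [hGF x hx] at hP
  change fderiv ℝ (piola F G vhat) (F x) = _ at hP
  have hi1 := DFunLike.congr_fun hinv (1, 0)
  have hi2 := DFunLike.congr_fun hinv (0, 1)
  simp only [ContinuousLinearMap.comp_apply, ContinuousLinearMap.id_apply] at hi1 hi2
  unfold vdiv
  rw [hP]
  simp only [ContinuousLinearMap.comp_apply, add_apply,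
    smul_apply, ContinuousLinearMap.smulRight_apply,
    ContinuousLinearMap.flip_apply, hJ'_apply]
  have hJ_eq := jacDet_eq F x
  rw [ContinuousLinearMap.apply_eq_smul_add_smul (fderiv ℝ F x) (fderiv ℝ G (F x) _)] at hi1 hi2
  generalize fderiv ℝ G (F x) (1, 0) = g₁ at *
  generalize fderiv ℝ G (F x) (0, 1) = g₂ at *
  have hDD₁ := ContinuousLinearMap.apply_eq_smul_add_smul (fderiv ℝ (fderiv ℝ F) x (1, 0)) (vhat x)
  have hDD₂ := ContinuousLinearMap.apply_eq_smul_add_smul (fderiv ℝ (fderiv ℝ F) x (0, 1)) (vhat x)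
  have hDv := ContinuousLinearMap.apply_eq_smul_add_smul (fderiv ℝ F x) (vhat x)
  have hDv₁ := ContinuousLinearMap.apply_eq_smul_add_smul (fderiv ℝ F x) (fderiv ℝ vhat x (1, 0))
  have hDv₂ := ContinuousLinearMap.apply_eq_smul_add_smul (fderiv ℝ F x) (fderiv ℝ vhat x (0, 1))
  rw [ContinuousLinearMap.apply_eq_smul_add_smul (fderiv ℝ vhat x) g₁,
    ContinuousLinearMap.apply_eq_smul_add_smul (fderiv ℝ vhat x) g₂,
    ContinuousLinearMap.apply_eq_smul_add_smul (fderiv ℝ (fderiv ℝ F) x) g₁,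
    ContinuousLinearMap.apply_eq_smul_add_smul (fderiv ℝ (fderiv ℝ F) x) g₂]
  simp only [map_add, map_smul, add_apply, smul_apply, hDD₁, hDD₂, hDv, hDv₁, hDv₂, ← hsymm,
    Function.comp_apply]
  simp only [Prod.ext_iff, Prod.fst_add, Prod.snd_add, Prod.smul_fst, Prod.smul_snd,
    smul_eq_mul] at hi1 hi2 ⊢
  rw [hJ_eq] at hJx ⊢
  generalize fderiv ℝ F x (1, 0) = d₁ at *
  generalize fderiv ℝ F x (0, 1) = d₂ at *
  have e₁ : g₁.1 = d₂.2 / (d₁.1 * d₂.2 - d₂.1 * d₁.2) := by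
    rw [eq_div_iff hJx]; linear_combination d₂.2 * hi1.1 - d₂.1 * hi1.2
  have e₂ : g₁.2 = -d₁.2 / (d₁.1 * d₂.2 - d₂.1 * d₁.2) := by
    rw [eq_div_iff hJx]; linear_combination d₁.1 * hi1.2 - d₁.2 * hi1.1
  have e₃ : g₂.1 = -d₂.1 / (d₁.1 * d₂.2 - d₂.1 * d₁.2) := by
    rw [eq_div_iff hJx]; linear_combination d₂.2 * hi2.1 - d₂.1 * hi2.2
  have e₄ : g₂.2 = d₁.1 / (d₁.1 * d₂.2 - d₂.1 * d₁.2) := by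
    rw [eq_div_iff hJx]; linear_combination d₁.1 * hi2.2 - d₁.2 * hi2.1
  rw [e₁, e₂, e₃, e₄]
  field_simp
  ring
end

section
/- Let K̂ be a bounded open subset of ℝ² and F : K̂ → K an injective map onto an open set K, twice differentiable on K̂ with differentiable inverse, whose Jacobian determinant J(x̂) = det DF(x̂) is strictly positive for every x̂ ∈ K̂. Let τ̂ : K̂ → M₂(ℝ) be a continuously differentiable 2×2 matrix field and v̂ : K̂ → ℝ² a measurable vector field such that (div τ̂)·v̂ (Euclidean dot product) is integrable on K̂. Then ∫_K div(P¹τ̂)(x) · (P⁰v̂)(x) dx = ∫_{K̂} (div τ̂)(x̂) · v̂(x̂) dx̂. -/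
open MeasureTheory

/-- The `i`-th row of a `2×2` matrix field, as a planar vector field. -/
def rowv (τ : ℝ × ℝ → Matrix (Fin 2) (Fin 2) ℝ) (i : Fin 2) (x : ℝ × ℝ) : ℝ × ℝ :=
  (τ x i 0, τ x i 1)

/-- The row-wise divergence of a `2×2` matrix field. -/
noncomputable def matDiv (τ : ℝ × ℝ → Matrix (Fin 2) (Fin 2) ℝ) (x : ℝ × ℝ) : ℝ × ℝ :=
  (vdiv (rowv τ 0) x, vdiv (rowv τ 1) x)

/-- The row-by-row Piola transform of a `2×2` matrix field. -/
noncomputable def piolaMat (F G : ℝ × ℝ → ℝ × ℝ) (τ : ℝ × ℝ → Matrix (Fin 2) (Fin 2) ℝ)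
    (x : ℝ × ℝ) : Matrix (Fin 2) (Fin 2) ℝ :=
  Matrix.of ![![(piola F G (rowv τ 0) x).1, (piola F G (rowv τ 0) x).2],
              ![(piola F G (rowv τ 1) x).1, (piola F G (rowv τ 1) x).2]]

/-- The Euclidean dot product on `ℝ²`. -/
def dotp (a b : ℝ × ℝ) : ℝ := a.1 * b.1 + a.2 * b.2

/-- The determinant of a linear endomorphism of the plane in coordinates. -/
theorem det_plane_eq (A : ℝ × ℝ →L[ℝ] ℝ × ℝ) :
    LinearMap.det A.toLinearMap
      = (A (1, 0)).1 * (A (0, 1)).2 - (A (0, 1)).1 * (A (1, 0)).2 := by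
  rw [← LinearMap.det_toMatrix (Module.Basis.finTwoProd ℝ), Matrix.det_fin_two]
  simp [LinearMap.toMatrix_apply]

/-- A continuous linear map on the plane is determined by the images of the coordinate vectors. -/
theorem clm_plane_apply {E : Type*} [NormedAddCommGroup E] [NormedSpace ℝ E]
    (A : ℝ × ℝ →L[ℝ] E) (h : ℝ × ℝ) :
    A h = h.1 • A (1, 0) + h.2 • A (0, 1) := by
  rw [← map_smul, ← map_smul, ← map_add]
  simp

/-- The Piola transform scales the divergence by the inverse Jacobian determinant. -/
theorem vdiv_piola {F G w : ℝ × ℝ → ℝ × ℝ} {y : ℝ × ℝ}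
    (hF : ∀ᶠ z in nhds y, DifferentiableAt ℝ F z)
    (hF2 : DifferentiableAt ℝ (fun z => fderiv ℝ F z) y)
    (hG : DifferentiableAt ℝ G (F y)) (hGF : ∀ᶠ z in nhds y, G (F z) = z)
    (hJ : jacDet F y ≠ 0) (hw : DifferentiableAt ℝ w y) :
    vdiv (piola F G w) (F y) = (jacDet F y)⁻¹ * vdiv w y := by
  have hGy : G (F y) = y := hGF.self_of_nhds
  set A := fderiv ℝ F y with hA
  set D := fderiv ℝ (fun z => fderiv ℝ F z) y with hD
  set W := fderiv ℝ w y with hW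
  set B := fderiv ℝ G (F y) with hB
  have hsymm : ∀ h k, D h k = D k h := fun h k =>
    second_derivative_symmetric_of_eventually
      (hF.mono fun z hz => hz.hasFDerivAt) hF2.hasFDerivAt h k
  have hBA : ∀ h, B (A h) = h := by
    have h1 : HasFDerivAt (G ∘ F) (B.comp A) y :=
      hG.hasFDerivAt.comp y hF.self_of_nhds.hasFDerivAt
    have h2 : HasFDerivAt (G ∘ F) (ContinuousLinearMap.id ℝ (ℝ × ℝ)) y :=
      (hasFDerivAt_id y).congr_of_eventuallyEq hGF
    intro h
    simpa using congrArg (fun L : ℝ × ℝ →L[ℝ] ℝ × ℝ => L h) (h1.unique h2)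
  have hentry : ∀ e, HasFDerivAt (fun z => fderiv ℝ F z e) (D.flip e) y := fun e => by
    simpa using hF2.hasFDerivAt.clm_apply (hasFDerivAt_const e y)
  have hJd := ((hentry (1, 0)).fst.mul (hentry (0, 1)).snd).sub
    ((hentry (0, 1)).fst.mul (hentry (1, 0)).snd)
  have hJfun : jacDet F = fun z => (fderiv ℝ F z (1, 0)).1 * (fderiv ℝ F z (0, 1)).2
      - (fderiv ℝ F z (0, 1)).1 * (fderiv ℝ F z (1, 0)).2 :=
    funext fun z => det_plane_eq _
  have hJd' := hJd.congr_of_eventuallyEq (Filter.Eventually.of_forall (congrFun hJfun))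
  have hH := (((hasDerivAt_inv hJ).comp_hasFDerivAt y hJd').smul
    (hF2.hasFDerivAt.clm_apply hw.hasFDerivAt))
  rw [← hGy] at hH
  have hP := hH.comp (F y) hG.hasFDerivAt
  have hPd := hP.fderiv
  rw [hGy] at hPd
  have hpi : fderiv ℝ (piola F G w) (F y) = _ := hPd
  have hJv : jacDet F y = (A (1, 0)).1 * (A (0, 1)).2 - (A (0, 1)).1 * (A (1, 0)).2 :=
    det_plane_eq _
  have e1 := hBA (1, 0)
  have e2 := hBA (0, 1)
  rw [clm_plane_apply B] at e1 e2
  unfold vdiv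
  rw [hpi]
  simp only [Prod.ext_iff, Prod.fst_add, Prod.snd_add, Prod.smul_fst, Prod.smul_snd,
    smul_eq_mul] at e1 e2
  have b1 : B (1, 0) = (jacDet F y)⁻¹ • ((A (0, 1)).2, -(A (1, 0)).2) := by
    rw [eq_inv_smul_iff₀ hJ, hJv]
    ext <;> simp only [Prod.smul_fst, Prod.smul_snd, smul_eq_mul]
    · linear_combination (A (0, 1)).2 * e1.1 - (A (1, 0)).2 * e2.1
    · linear_combination (A (0, 1)).2 * e1.2 - (A (1, 0)).2 * e2.2
  have b2 : B (0, 1) = (jacDet F y)⁻¹ • (-(A (0, 1)).1, (A (1, 0)).1) := by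
    rw [eq_inv_smul_iff₀ hJ, hJv]
    ext <;> simp only [Prod.smul_fst, Prod.smul_snd, smul_eq_mul]
    · linear_combination (A (1, 0)).1 * e2.1 - (A (0, 1)).1 * e1.1
    · linear_combination (A (1, 0)).1 * e2.2 - (A (0, 1)).1 * e1.2
  simp only [ContinuousLinearMap.comp_apply, ← hB, ← hA, ← hD, ← hW, b1, b2, map_smul]
  simp only [Function.comp_apply, add_apply,
    smul_apply, sub_apply,
    ContinuousLinearMap.smulRight_apply, ContinuousLinearMap.comp_apply,
    ContinuousLinearMap.flip_apply, ContinuousLinearMap.coe_fst', ContinuousLinearMap.coe_snd']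
  rw [clm_plane_apply A (W _), clm_plane_apply A (W _), clm_plane_apply A (w y),
    clm_plane_apply W (_, -_), clm_plane_apply W (-_, _),
    clm_plane_apply D (_, -_), clm_plane_apply D (-_, _)]
  simp only [add_apply, smul_apply]
  rw [clm_plane_apply (D (1, 0)) (w y), clm_plane_apply (D (0, 1)) (w y), hsymm (0, 1) (1, 0)]
  simp only [Prod.fst_add, Prod.snd_add, Prod.smul_fst, Prod.smul_snd, smul_eq_mul]
  rw [hJv] at hJ ⊢
  generalize A (1, 0) = a at *
  generalize A (0, 1) = b at *
  field_simp
  ring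

/-- Second integral identity of the transformation lemma (paper's equation (6)):
`(div (P¹ τ̂), P⁰ v̂)_{L²(K)} = (div τ̂, v̂)_{L²(K̂)}` for a `C¹` matrix field `τ̂` and a
measurable vector field `v̂` with `(div τ̂)·v̂` integrable on `K̂`. -/
theorem stmt_4
    (Khat K : Set (ℝ × ℝ)) (hKhat : IsOpen Khat) (hKb : Bornology.IsBounded Khat)
    (hK : IsOpen K)
    (F G : ℝ × ℝ → ℝ × ℝ)
    (hFinj : Set.InjOn F Khat) (hFK : F '' Khat = K)
    (hdF : ∀ xhat ∈ Khat, DifferentiableAt ℝ F xhat)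
    (hdF2 : ∀ xhat ∈ Khat, DifferentiableAt ℝ (fun y => fderiv ℝ F y) xhat)
    (hdG : ∀ x ∈ K, DifferentiableAt ℝ G x)
    (hGF : ∀ xhat ∈ Khat, G (F xhat) = xhat)
    (hFG : ∀ x ∈ K, F (G x) = x)
    (hJpos : ∀ xhat ∈ Khat, 0 < jacDet F xhat)
    (τ : ℝ × ℝ → Matrix (Fin 2) (Fin 2) ℝ)
    (hτ : ∀ i : Fin 2, ContDiffOn ℝ 1 (rowv τ i) Khat)
    (v : ℝ × ℝ → ℝ × ℝ) (hvm : Measurable v)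
    (hint : IntegrableOn (fun xhat => dotp (matDiv τ xhat) (v xhat)) Khat) :
    ∫ x in K, dotp (matDiv (piolaMat F G τ) x) (v (G x))
      = ∫ xhat in Khat, dotp (matDiv τ xhat) (v xhat) := by
  have hnhds : ∀ y ∈ Khat, Khat ∈ nhds y := fun y hy => hKhat.mem_nhds hy
  have hdiv : ∀ y ∈ Khat, ∀ i,
      vdiv (piola F G (rowv τ i)) (F y) = (jacDet F y)⁻¹ * vdiv (rowv τ i) y := by
    intro y hy i
    exact vdiv_piola (Filter.eventually_of_mem (hnhds y hy) hdF) (hdF2 y hy)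
      (hdG _ (hFK ▸ Set.mem_image_of_mem F hy))
      (Filter.eventually_of_mem (hnhds y hy) hGF) (hJpos y hy).ne'
      (((hτ i).differentiableOn one_ne_zero).differentiableAt (hnhds y hy))
  have hrow : ∀ i, rowv (piolaMat F G τ) i = piola F G (rowv τ i) := by
    intro i
    funext x
    fin_cases i <;> simp [rowv, piolaMat]
  rw [← hFK, integral_image_eq_integral_abs_det_fderiv_smul volume hKhat.measurableSet
    (fun y hy => (hdF y hy).hasFDerivAt.hasFDerivWithinAt) hFinj]
  refine setIntegral_congr_fun hKhat.measurableSet fun y hy => ?_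
  have hJ := hJpos y hy
  have hdet : (fderiv ℝ F y).det = jacDet F y := rfl
  simp only [matDiv, hrow, hdiv y hy, hGF y hy, hdet, abs_of_pos hJ, dotp, smul_eq_mul]
  field_simp
end

section
/- Let Σ, V, Q, W be real Hilbert spaces and let T : Σ → V, S : Σ → Q, C : W → Σ, L : W → Q be bounded linear operators satisfying T∘C = 0 and S∘C = −L. Assume there exist constants c₃, c₄ > 0 such that: for every q ∈ Q there is w ∈ W with L w = q and ‖w‖ ≤ c₃⁻¹‖q‖, and for every v ∈ V there is η ∈ Σ with T η = v and ‖η‖ ≤ c₄⁻¹‖v‖. Then for every v ∈ V and q ∈ Q there exists τ ∈ Σ with T τ = v, S τ = q, and ‖τ‖ ≤ M(‖v‖ + ‖q‖), where one may take M = c₄⁻¹(1 + ‖C‖ c₃⁻¹ ‖S‖) + ‖C‖ c₃⁻¹. Consequently, choosing such τ for given (v, q) ≠ (0, 0) yields ⟨Tτ, v⟩ + ⟨Sτ, q⟩ = ‖v‖² + ‖q‖² ≥ (2M)⁻¹ ‖τ‖ (‖v‖ + ‖q‖). -/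
open scoped RealInnerProductSpace

/-- Abstract form of the paper's Theorem 1: from a right inverse of `L` (Stokes inf-sup)
and a right inverse of `T` (mixed Poisson inf-sup), together with the compatibility
relations `T ∘ C = 0` and `S ∘ C = −L`, one constructs for every `(v, q)` an element `τ`
with `T τ = v`, `S τ = q` and `‖τ‖ ≤ M (‖v‖ + ‖q‖)`, where
`M = c₄⁻¹ (1 + ‖C‖ c₃⁻¹ ‖S‖) + ‖C‖ c₃⁻¹`; consequently
`⟪T τ, v⟫ + ⟪S τ, q⟫ = ‖v‖² + ‖q‖² ≥ (2M)⁻¹ ‖τ‖ (‖v‖ + ‖q‖)` whenever `(v, q) ≠ 0`. -/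
theorem stmt_5
    {Sg V Q W : Type*}
    [NormedAddCommGroup Sg] [InnerProductSpace ℝ Sg] [CompleteSpace Sg]
    [NormedAddCommGroup V] [InnerProductSpace ℝ V] [CompleteSpace V]
    [NormedAddCommGroup Q] [InnerProductSpace ℝ Q] [CompleteSpace Q]
    [NormedAddCommGroup W] [InnerProductSpace ℝ W] [CompleteSpace W]
    (T : Sg →L[ℝ] V) (S : Sg →L[ℝ] Q) (C : W →L[ℝ] Sg) (L : W →L[ℝ] Q)
    (hTC : T.comp C = 0) (hSC : S.comp C = -L)
    (c₃ c₄ : ℝ) (hc₃ : 0 < c₃) (hc₄ : 0 < c₄)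
    (hL : ∀ q : Q, ∃ w : W, L w = q ∧ ‖w‖ ≤ c₃⁻¹ * ‖q‖)
    (hT : ∀ v : V, ∃ η : Sg, T η = v ∧ ‖η‖ ≤ c₄⁻¹ * ‖v‖) :
    ∀ (v : V) (q : Q), ∃ τ : Sg,
      T τ = v ∧ S τ = q ∧
      ‖τ‖ ≤ (c₄⁻¹ * (1 + ‖C‖ * c₃⁻¹ * ‖S‖) + ‖C‖ * c₃⁻¹) * (‖v‖ + ‖q‖) ∧
      ⟪T τ, v⟫ + ⟪S τ, q⟫ = ‖v‖ ^ 2 + ‖q‖ ^ 2 ∧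
      ((v, q) ≠ 0 →
        (2 * (c₄⁻¹ * (1 + ‖C‖ * c₃⁻¹ * ‖S‖) + ‖C‖ * c₃⁻¹))⁻¹ * (‖τ‖ * (‖v‖ + ‖q‖))
          ≤ ‖v‖ ^ 2 + ‖q‖ ^ 2) := by
  intro v q
  obtain ⟨η, hTη, hη⟩ := hT v
  obtain ⟨w, hLw, hw⟩ := hL (q - S η)
  have hTCw : T (C w) = 0 := by simpa using DFunLike.congr_fun hTC w
  have hSCw : S (C w) = -L w := by simpa using DFunLike.congr_fun hSC w
  have hTτ : T (η - C w) = v := by rw [map_sub, hTη, hTCw, sub_zero]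
  have hSτ : S (η - C w) = q := by rw [map_sub, hSCw, hLw]; abel
  set M := c₄⁻¹ * (1 + ‖C‖ * c₃⁻¹ * ‖S‖) + ‖C‖ * c₃⁻¹
  have hMpos : 0 < M := by positivity
  have hτ : ‖η - C w‖ ≤ M * (‖v‖ + ‖q‖) := calc
    ‖η - C w‖ ≤ ‖η‖ + ‖C‖ * ‖w‖ := (norm_sub_le _ _).trans (by gcongr; exact C.le_opNorm w)
    _ ≤ ‖η‖ + ‖C‖ * (c₃⁻¹ * (‖q‖ + ‖S‖ * ‖η‖)) := by
      gcongr
      refine hw.trans ?_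
      gcongr
      exact (norm_sub_le _ _).trans (by gcongr; exact S.le_opNorm η)
    _ ≤ c₄⁻¹ * ‖v‖ + ‖C‖ * (c₃⁻¹ * (‖q‖ + ‖S‖ * (c₄⁻¹ * ‖v‖))) := by gcongr
    _ = c₄⁻¹ * (1 + ‖C‖ * c₃⁻¹ * ‖S‖) * ‖v‖ + ‖C‖ * c₃⁻¹ * ‖q‖ := by ring
    _ ≤ M * ‖v‖ + M * ‖q‖ := by
      gcongr
      · exact le_add_of_nonneg_right (by positivity)
      · exact le_add_of_nonneg_left (by positivity)
    _ = M * (‖v‖ + ‖q‖) := by ring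
  refine ⟨η - C w, hTτ, hSτ, hτ, ?_, fun _ => ?_⟩
  · rw [hTτ, hSτ, real_inner_self_eq_norm_sq, real_inner_self_eq_norm_sq]
  · rw [inv_mul_le_iff₀ (by positivity)]
    calc ‖η - C w‖ * (‖v‖ + ‖q‖) ≤ M * (‖v‖ + ‖q‖) * (‖v‖ + ‖q‖) := by gcongr
      _ = M * (‖v‖ + ‖q‖) ^ 2 := by ring
      _ ≤ M * (2 * (‖v‖ ^ 2 + ‖q‖ ^ 2)) := by gcongr; exact add_sq_le
      _ = 2 * M * (‖v‖ ^ 2 + ‖q‖ ^ 2) := by ring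
end

section
/- Let Y be a real vector space equipped with two norms ‖·‖_Y and ‖·‖₀ satisfying ‖z‖₀ ≤ ‖z‖_Y for all z ∈ Y, let B : Y × Y → ℝ be a bilinear form, and let Y_h ⊆ Y be a subspace. Assume: (i) there is c₀ > 0 such that for every y ∈ Y_h there exists a nonzero z ∈ Y_h with B(y, z) ≥ c₀‖y‖_Y‖z‖_Y; (ii) y ∈ Y and y_h ∈ Y_h satisfy the Galerkin orthogonality B(y − y_h, z) = 0 for all z ∈ Y_h; (iii) there are ȳ ∈ Y_h and C ≥ 0 such that B(y − ȳ, z) ≤ C‖y − ȳ‖₀‖z‖_Y for all z ∈ Y_h. Then ‖y − y_h‖₀ ≤ (1 + C/c₀)‖y − ȳ‖₀. -/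
/-- Abstract form of the paper's Theorem 3 (L² error estimate): if a bilinear form `B`
satisfies the discrete inf-sup condition (i) on a subspace `Yh` with respect to the norm
`‖·‖_Y`, if `y, yh` satisfy Galerkin orthogonality (ii), and if the approximation error
`y − ȳ` satisfies the bound (iii) in a weaker norm `n = ‖·‖₀` with `n ≤ ‖·‖_Y`, then
`n (y − yh) ≤ (1 + C/c₀) n (y − ȳ)`. -/
theorem stmt_7
    {Y : Type*} [NormedAddCommGroup Y] [NormedSpace ℝ Y]
    (n : Y → ℝ)
    (hn0 : ∀ z : Y, n z = 0 ↔ z = 0)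
    (hnadd : ∀ z w : Y, n (z + w) ≤ n z + n w)
    (hnsmul : ∀ (c : ℝ) (z : Y), n (c • z) = |c| * n z)
    (hnle : ∀ z : Y, n z ≤ ‖z‖)
    (B : Y →ₗ[ℝ] Y →ₗ[ℝ] ℝ)
    (Yh : Submodule ℝ Y)
    (c₀ : ℝ) (hc₀ : 0 < c₀)
    (hinfsup : ∀ y ∈ Yh, ∃ z ∈ Yh, z ≠ 0 ∧ c₀ * (‖y‖ * ‖z‖) ≤ B y z)
    (y : Y) (yh : Y) (hyh : yh ∈ Yh)
    (hgalerkin : ∀ z ∈ Yh, B (y - yh) z = 0)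
    (ybar : Y) (hybar : ybar ∈ Yh)
    (C : ℝ) (hC : 0 ≤ C)
    (hbound : ∀ z ∈ Yh, B (y - ybar) z ≤ C * (n (y - ybar) * ‖z‖)) :
    n (y - yh) ≤ (1 + C / c₀) * n (y - ybar) := by
  obtain ⟨z, hz, hz0, hstab⟩ := hinfsup (ybar - yh) (Yh.sub_mem hybar hyh)
  have hconsistent : B (ybar - yh) z = B (y - ybar) (-z) := by
    have h := hgalerkin z hz
    simp only [map_sub, map_neg, LinearMap.sub_apply] at h ⊢
    linarith
  have hneg := hbound (-z) (Yh.neg_mem hz)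
  rw [norm_neg, ← hconsistent] at hneg
  have hscaled : c₀ * ‖ybar - yh‖ ≤ C * n (y - ybar) := by
    refine le_of_mul_le_mul_right ?_ (norm_pos_iff.mpr hz0)
    linarith
  have hdist : ‖ybar - yh‖ ≤ C / c₀ * n (y - ybar) := by
    rw [div_mul_eq_mul_div, le_div_iff₀ hc₀, mul_comm]
    exact hscaled
  calc n (y - yh) = n ((y - ybar) + (ybar - yh)) := by rw [sub_add_sub_cancel]
    _ ≤ n (y - ybar) + n (ybar - yh) := hnadd _ _
    _ ≤ n (y - ybar) + C / c₀ * n (y - ybar) := by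
      gcongr
      exact (hnle _).trans hdist
    _ = (1 + C / c₀) * n (y - ybar) := by ring
end
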